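/- Let D be a directed set with widening ▽ and narrowing △ satisfying the standard chain conditions (no infinite strictly ascending ▽-sequence, no infinite strictly descending △-sequence), and consider a system of n monotone equations with explicitly given dependency sets dep_i. Then structured worklist iteration (solver SW) with the combined operator ⊟, started from any initial assignment with all unknowns in the priority queue, terminates; upon termination the resulting assignment ρ satisfies f_i ρ ⊑ ρ x_i for all i. -/

import Mathlib

open Classical in
noncomputable def combine {D : Type*} [Preorder D] (w nar : D → D → D) (a b : D) : D :=
  if b ≤ a then nar a b else w a b

open Classical in
noncomputable def swStep {D : Type*} (box : D → D → D) (f : ℕ → (ℕ → D) → D)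
    (infl : ℕ → Finset ℕ) : (ℕ → D) × Finset ℕ → (ℕ → D) × Finset ℕ :=
  fun s =>
    if h : s.2.Nonempty then
      let i := s.2.min' h
      let newv := box (s.1 i) (f i s.1)
      if newv = s.1 i then (s.1, s.2.erase i)
      else (Function.update s.1 i newv, s.2.erase i ∪ infl i)
    else s

open Filter in
/-- A sequence that changes infinitely often, with all late changes related by `r`, yields an
infinite `r`-chain of consecutively distinct elements. -/
theorem exists_chain_of_frequently_ne {D : Type*} (r : D → D → Prop) (g : ℕ → D) (N : ℕ)
    (hg : ∃ᶠ t in atTop, g (t + 1) ≠ g t)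
    (hr : ∀ t, N ≤ t → g (t + 1) ≠ g t → r (g t) (g (t + 1))) :
    ∃ d : ℕ → D, ∀ k, d (k + 1) ≠ d k ∧ r (d k) (d (k + 1)) := by
  have hnext : ∀ t, ∃ u, t ≤ u ∧ g (u + 1) ≠ g u ∧ g u = g t := by
    intro t
    have hex : ∃ u, t ≤ u ∧ g (u + 1) ≠ g u := frequently_atTop.1 hg t
    classical
    refine ⟨Nat.find hex, (Nat.find_spec hex).1, (Nat.find_spec hex).2, ?_⟩
    have hconst : ∀ v, t ≤ v → v ≤ Nat.find hex → g v = g t := by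
      intro v htv
      induction v, htv using Nat.le_induction with
      | base => intro _; rfl
      | succ v htv ih =>
        intro hv
        have hmin := Nat.find_min hex (m := v) (by omega)
        rw [← ih (by omega)]
        by_contra hne
        exact hmin ⟨htv, hne⟩
    exact hconst _ (Nat.find_spec hex).1 le_rfl
  choose next hle hne heq using hnext
  let τ : ℕ → ℕ := fun k => Nat.rec (next N) (fun _ t => next (t + 1)) k
  have hτ : ∀ k, N ≤ τ k ∧ g (τ k + 1) ≠ g (τ k) := by
    intro k
    induction k with
    | zero => exact ⟨hle N, hne N⟩
    | succ k ih => exact ⟨ih.1.trans ((Nat.le_succ _).trans (hle (τ k + 1))), hne (τ k + 1)⟩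
  have hsucc : ∀ k, g (τ (k + 1)) = g (τ k + 1) := fun k => heq (τ k + 1)
  refine ⟨fun k => g (τ k), fun k => ?_⟩
  simp only [hsucc]
  exact ⟨(hτ k).2, hr _ (hτ k).1 (hτ k).2⟩

theorem swStep_cases {D : Type*} (box : D → D → D) (f : ℕ → (ℕ → D) → D)
    (infl : ℕ → Finset ℕ) (s : (ℕ → D) × Finset ℕ) (hs : s.2.Nonempty) :
    ∃ i ∈ s.2, (∀ j ∈ s.2, i ≤ j) ∧
      ((box (s.1 i) (f i s.1) = s.1 i ∧ swStep box f infl s = (s.1, s.2.erase i)) ∨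
       (box (s.1 i) (f i s.1) ≠ s.1 i ∧ swStep box f infl s =
          (Function.update s.1 i (box (s.1 i) (f i s.1)), s.2.erase i ∪ infl i))) := by
  refine ⟨s.2.min' hs, s.2.min'_mem hs, fun j hj => s.2.min'_le j hj, ?_⟩
  by_cases h : box (s.1 (s.2.min' hs)) (f (s.2.min' hs) s.1) = s.1 (s.2.min' hs)
  · exact Or.inl ⟨h, by simp [swStep, hs, h]⟩
  · exact Or.inr ⟨h, by simp [swStep, hs, h]⟩

theorem le_of_combine_eq {D : Type*} [PartialOrder D] {w nar : D → D → D}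
    (hw2 : ∀ a b, b ≤ w a b) {a b : D} (h : combine w nar a b = a) : b ≤ a := by
  by_contra hba
  rw [combine, if_neg hba] at h
  exact hba ((hw2 a b).trans_eq h)

/-- The unknowns outside the queue are stable. -/
def QueueInvariant {D : Type*} (box : D → D → D) (f : ℕ → (ℕ → D) → D) (n : ℕ)
    (s : (ℕ → D) × Finset ℕ) : Prop :=
  s.2 ⊆ Finset.range n ∧ ∀ j < n, j ∉ s.2 → box (s.1 j) (f j s.1) = s.1 j

open Classical in
theorem QueueInvariant.swStep {D : Type*} {box : D → D → D} {f : ℕ → (ℕ → D) → D} {n : ℕ}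
    {dep : ℕ → Finset ℕ}
    (hdep : ∀ i (ρ ρ' : ℕ → D), (∀ j ∈ dep i, ρ j = ρ' j) → f i ρ = f i ρ')
    {s : (ℕ → D) × Finset ℕ} (hs : QueueInvariant box f n s) :
    QueueInvariant box f n (swStep box f
      (fun i => ((Finset.range n).filter (fun j => i ∈ dep j)) ∪ {i}) s) := by
  by_cases hne : s.2.Nonempty
  swap
  · simpa [_root_.swStep, hne] using hs
  obtain ⟨i, hi, -, ⟨hb, he⟩ | ⟨-, he⟩⟩ := swStep_cases box f
    (fun i => ((Finset.range n).filter (fun j => i ∈ dep j)) ∪ {i}) s hne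
  · rw [he]
    refine ⟨(Finset.erase_subset _ _).trans hs.1, fun j hj hjQ => ?_⟩
    by_cases hji : j = i
    · subst hji; exact hb
    · exact hs.2 j hj fun h => hjQ (Finset.mem_erase.2 ⟨hji, h⟩)
  · rw [he]
    refine ⟨?_, fun j hj hjQ => ?_⟩
    · refine Finset.union_subset ((Finset.erase_subset _ _).trans hs.1)
        (Finset.union_subset (Finset.filter_subset _ _) ?_)
      exact Finset.singleton_subset_iff.2 (hs.1 hi)
    · simp only [Finset.mem_union, Finset.mem_erase, Finset.mem_filter, Finset.mem_range,
        Finset.mem_singleton, not_or, not_and] at hjQ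
      obtain ⟨hjQ, hjdep, hji⟩ := hjQ
      have hf : f j (Function.update s.1 i (box (s.1 i) (f i s.1))) = f j s.1 := by
        refine hdep j _ _ fun l hl => Function.update_of_ne ?_ _ _
        rintro rfl
        exact hjdep hj hl
      simp only [hf, Function.update_of_ne hji]
      exact hs.2 j hj (hjQ hji)

/-- With a monotone system, no run changes `m` infinitely often once all unknowns larger than `m`
have settled and each update of an unknown happens with all smaller ones satisfied. -/
theorem false_of_frequently_ne {D : Type*} [PartialOrder D] (w nar : D → D → D)
    (hn : ∀ a b, b ≤ a → b ≤ nar a b ∧ nar a b ≤ a)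
    (hwterm : ∀ d b : ℕ → D, (∀ i, d (i+1) = w (d i) (b i)) →
      ∃ N, ∀ m, N ≤ m → d m = d N)
    (hnterm : ∀ d b : ℕ → D, (∀ i, b i ≤ d i ∧ d (i+1) = nar (d i) (b i)) →
      ∃ N, ∀ m, N ≤ m → d m = d N)
    (f : ℕ → (ℕ → D) → D) (hmono : ∀ i, Monotone (f i))
    (ρ : ℕ → ℕ → D) (m N : ℕ)
    (hfreq : ∃ᶠ t in Filter.atTop, ρ (t + 1) m ≠ ρ t m)
    (hstep : ∀ t, N ≤ t → ρ (t + 1) = ρ t ∨ ∃ i ≤ m, (∀ j < i, f j (ρ t) ≤ ρ t j) ∧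
      ρ (t + 1) = Function.update (ρ t) i (combine w nar (ρ t i) (f i (ρ t)))) : False := by
  have hm : ∀ t, N ≤ t → ρ (t + 1) m ≠ ρ t m → (∀ j < m, f j (ρ t) ≤ ρ t j) ∧
      ρ (t + 1) m = combine w nar (ρ t m) (f m (ρ t)) := by
    intro t ht hne
    obtain h | ⟨i, -, hlt, h⟩ := hstep t ht
    · exact absurd (congrFun h m) hne
    · obtain rfl : m = i := by
        by_contra hmi
        exact hne (by rw [h, Function.update_of_ne hmi])
      exact ⟨hlt, by rw [h, Function.update_self]⟩
  by_cases hnar : ∃ t, N ≤ t ∧ ρ (t + 1) m ≠ ρ t m ∧ f m (ρ t) ≤ ρ t m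
  · obtain ⟨T, hT, hne, hle⟩ := hnar
    have hpost : ∀ t, T ≤ t → ∀ j ≤ m, f j (ρ t) ≤ ρ t j := by
      intro t ht
      induction t, ht using Nat.le_induction with
      | base =>
        intro j hj
        rcases hj.lt_or_eq with hj | rfl
        · exact (hm T hT hne).1 j hj
        · exact hle
      | succ t ht ih =>
        obtain h | ⟨i, him, -, h⟩ := hstep t (hT.trans ht)
        · rw [h]; exact ih
        · have hi := ih i him
          rw [combine, if_pos hi] at h
          have hdesc : ρ (t + 1) ≤ ρ t := by
            rw [h]; exact update_le_self_iff.2 (hn _ _ hi).2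
          intro j hj
          refine (hmono j hdesc).trans ?_
          by_cases hji : j = i
          · subst hji
            rw [h, Function.update_self]
            exact (hn _ _ hi).1
          · rw [h, Function.update_of_ne hji]
            exact ih j hj
    obtain ⟨d, hd⟩ := exists_chain_of_frequently_ne (fun a a' => ∃ b, b ≤ a ∧ a' = nar a b)
      (fun t => ρ t m) T hfreq fun t ht hne => by
        have hle := hpost t ht m le_rfl
        exact ⟨_, hle, by rw [(hm t (hT.trans ht) hne).2, combine, if_pos hle]⟩
    choose hdne b hb using hd
    obtain ⟨K, hK⟩ := hnterm d b hb
    exact hdne K (hK _ K.le_succ)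
  · obtain ⟨d, hd⟩ := exists_chain_of_frequently_ne (fun a a' => ∃ b, a' = w a b)
      (fun t => ρ t m) N hfreq fun t ht hne =>
        ⟨_, by rw [(hm t ht hne).2, combine, if_neg fun hle => hnar ⟨t, ht, hne, hle⟩]⟩
    choose hdne b hb using hd
    obtain ⟨K, hK⟩ := hwterm d b hb
    exact hdne K (hK _ K.le_succ)

open Classical in
theorem stmt9 {D : Type*} [PartialOrder D]
    (hdir : ∀ a b : D, ∃ c, a ≤ c ∧ b ≤ c)
    (w nar : D → D → D)
    (hw1 : ∀ a b, a ≤ w a b) (hw2 : ∀ a b, b ≤ w a b)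
    (hn : ∀ a b, b ≤ a → b ≤ nar a b ∧ nar a b ≤ a)
    (hwterm : ∀ d b : ℕ → D, (∀ i, d (i+1) = w (d i) (b i)) →
      ∃ N, ∀ m, N ≤ m → d m = d N)
    (hnterm : ∀ d b : ℕ → D, (∀ i, b i ≤ d i ∧ d (i+1) = nar (d i) (b i)) →
      ∃ N, ∀ m, N ≤ m → d m = d N)
    (n : ℕ) (f : ℕ → (ℕ → D) → D) (hmono : ∀ i, Monotone (f i))
    (dep : ℕ → Finset ℕ)
    (hdep : ∀ i (ρ ρ' : ℕ → D), (∀ j ∈ dep i, ρ j = ρ' j) → f i ρ = f i ρ')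
    (ρ0 : ℕ → D) :
    ∃ k : ℕ, ∀ s : (ℕ → D) × Finset ℕ,
      s = (swStep (combine w nar) f
            (fun i => ((Finset.range n).filter (fun j => i ∈ dep j)) ∪ {i}))^[k]
            (ρ0, Finset.range n) →
      s.2 = ∅ ∧ ∀ i, i < n → f i s.1 ≤ s.1 i := by
  set step := swStep (combine w nar) f
    (fun i => ((Finset.range n).filter (fun j => i ∈ dep j)) ∪ {i}) with hstepdef
  set S : ℕ → (ℕ → D) × Finset ℕ := fun t => step^[t] (ρ0, Finset.range n)
  have hSsucc : ∀ t, S (t + 1) = step (S t) := fun t => Function.iterate_succ_apply' _ _ _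
  have hinv : ∀ t, QueueInvariant (combine w nar) f n (S t) := by
    intro t
    induction t with
    | zero => exact ⟨subset_rfl, fun j hj hjQ => absurd (Finset.mem_range.2 hj) hjQ⟩
    | succ t ih => rw [hSsucc]; exact ih.swStep hdep
  have hpost : ∀ t, ∀ j < n, j ∉ (S t).2 → f j (S t).1 ≤ (S t).1 j :=
    fun t j hj hjQ => le_of_combine_eq hw2 ((hinv t).2 j hj hjQ)
  suffices hterm : ∃ k, (S k).2 = ∅ by
    obtain ⟨k, hk⟩ := hterm
    refine ⟨k, ?_⟩
    rintro s rfl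
    exact ⟨hk, fun i hi => hpost k i hi (by simp [hk])⟩
  by_contra! hne
  have hcases : ∀ t, ((S (t + 1)).1 = (S t).1 ∧ (S (t + 1)).2.card < (S t).2.card) ∨
      ∃ i < n, (∀ j < i, f j (S t).1 ≤ (S t).1 j) ∧ (S (t + 1)).1 i ≠ (S t).1 i ∧
        (S (t + 1)).1 = Function.update (S t).1 i
          (combine w nar ((S t).1 i) (f i (S t).1)) := by
    intro t
    obtain ⟨i, hi, hmin, ⟨-, he⟩ | ⟨hb, he⟩⟩ := swStep_cases (combine w nar) f
      (fun i => ((Finset.range n).filter (fun j => i ∈ dep j)) ∪ {i}) (S t) (hne t)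
    · left
      rw [hSsucc, hstepdef, he]
      exact ⟨rfl, Finset.card_erase_lt_of_mem hi⟩
    · right
      have hin := Finset.mem_range.1 ((hinv t).1 hi)
      rw [hSsucc, hstepdef, he]
      exact ⟨i, hin, fun j hj => hpost t j (hj.trans hin) fun hjQ => (hmin j hjQ).not_gt hj,
        by simpa using hb, rfl⟩
  have hchange : ∃ i < n, ∃ᶠ t in Filter.atTop, (S (t + 1)).1 i ≠ (S t).1 i := by
    by_contra! hnone
    have hall : ∀ᶠ t in Filter.atTop, ∀ i ∈ Finset.range n, (S (t + 1)).1 i = (S t).1 i :=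
      (Filter.eventually_all_finset _).2 fun i hi => by
        simpa [Filter.not_frequently] using hnone i (Finset.mem_range.1 hi)
    obtain ⟨N, hN⟩ := Filter.eventually_atTop.1 hall
    have hcard : ∀ k, (S (N + k)).2.card + k ≤ (S N).2.card := by
      intro k
      induction k with
      | zero => exact le_rfl
      | succ k ih =>
        obtain ⟨-, h⟩ | ⟨i, hi, -, h, -⟩ := hcases (N + k)
        · rw [add_assoc] at h; omega
        · exact absurd (hN _ (Nat.le_add_right _ _) i (Finset.mem_range.2 hi)) h
    have := hcard ((S N).2.card + 1)
    omega
  obtain ⟨m, ⟨-, hfreq⟩, hmax⟩ : ∃ m, (m < n ∧ ∃ᶠ t in Filter.atTop,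
      (S (t + 1)).1 m ≠ (S t).1 m) ∧ ∀ i < n, m < i →
        ¬ ∃ᶠ t in Filter.atTop, (S (t + 1)).1 i ≠ (S t).1 i := by
    obtain ⟨i, hi, hfi⟩ := hchange
    obtain ⟨m, hm⟩ := ((Finset.range n).filter
      fun i => ∃ᶠ t in Filter.atTop, (S (t + 1)).1 i ≠ (S t).1 i).exists_maximal
        ⟨i, Finset.mem_filter.2 ⟨Finset.mem_range.2 hi, hfi⟩⟩
    have hmem := Finset.mem_filter.1 hm.prop
    exact ⟨m, ⟨Finset.mem_range.1 hmem.1, hmem.2⟩, fun i hi hmi hfi =>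
      hm.not_gt (Finset.mem_filter.2 ⟨Finset.mem_range.2 hi, hfi⟩) hmi⟩
  have hall : ∀ᶠ t in Filter.atTop, ∀ i ∈ Finset.range n,
      m < i → (S (t + 1)).1 i = (S t).1 i :=
    (Filter.eventually_all_finset _).2 fun i hi => by
      by_cases hmi : m < i
      · simpa [Filter.not_frequently, hmi] using hmax i (Finset.mem_range.1 hi) hmi
      · simp [hmi]
  obtain ⟨N, hN⟩ := Filter.eventually_atTop.1 hall
  refine false_of_frequently_ne w nar hn hwterm hnterm f hmono (fun t => (S t).1) m N hfreq
    fun t ht => ?_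
  obtain ⟨h, -⟩ | ⟨i, hi, hlt, hine, h⟩ := hcases t
  · exact Or.inl h
  · exact Or.inr ⟨i, not_lt.1 fun hmi => hine (hN t ht i (Finset.mem_range.2 hi) hmi), hlt, h⟩
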